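/- Fix τ ∈ (0, 1/2). Let (n_j) be a sequence of positive integers with n_j → ∞ and (k_j) a sequence of positive integers with k_j/n_j → τ. For each j let S_{k_j} be the (k_j+1)×(k_j+1) symmetric tridiagonal matrix with zero diagonal and off-diagonal entries √((i+1)(n_j−i)) for i = 0,…,k_j−1. Then λmax(S_{k_j})/n_j → 2√(τ(1−τ)) as j → ∞. -/

import Mathlib

/-- Symmetric tridiagonal (k+1)×(k+1) matrix with diagonal `d 0, …, d k` and
off-diagonal `o 0, …, o (k-1)`. -/
noncomputable def Tridiag (k : ℕ) (d o : ℕ → ℝ) : Matrix (Fin (k + 1)) (Fin (k + 1)) ℝ :=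
  Matrix.of fun i j =>
    if (i : ℕ) = (j : ℕ) then d i
    else if (i : ℕ) + 1 = (j : ℕ) then o i
    else if (j : ℕ) + 1 = (i : ℕ) then o j
    else 0

/-- The largest eigenvalue of a real square matrix. -/
noncomputable def maxEig {m : ℕ} (M : Matrix (Fin m) (Fin m) ℝ) : ℝ :=
  sSup {μ : ℝ | Module.End.HasEigenvalue (Matrix.toLin' M) μ}

open Filter

theorem Tridiag_zero_apply (k : ℕ) (o : ℕ → ℝ) (i j : Fin (k + 1)) :
    Tridiag k (fun _ => 0) o i j =
      (if (i : ℕ) + 1 = j then o i else 0) + (if (j : ℕ) + 1 = i then o j else 0) := by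
  simp only [Tridiag, Matrix.of_apply]
  split_ifs <;> first | omega | simp

theorem Tridiag_isHermitian (k : ℕ) (o : ℕ → ℝ) :
    (Tridiag k (fun _ => 0) o).IsHermitian := by
  ext i j
  simp only [Matrix.conjTranspose_apply, Tridiag_zero_apply, star_trivial]
  exact add_comm _ _

/-- Gershgorin bound for the eigenvalues of a tridiagonal matrix with zero diagonal. -/
theorem Tridiag_eigenvalue_le {k : ℕ} {o : ℕ → ℝ} {M : ℝ} (hM : 0 ≤ M)
    (ho : ∀ i < k, |o i| ≤ M) {μ : ℝ}
    (hμ : Module.End.HasEigenvalue (Matrix.toLin' (Tridiag k (fun _ => 0) o)) μ) :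
    μ ≤ 2 * M := by
  obtain ⟨i, hi⟩ := eigenvalue_mem_ball hμ
  rw [Metric.mem_closedBall, Real.dist_eq, Tridiag_zero_apply] at hi
  simp only [Nat.succ_ne_self, if_false, add_zero, sub_zero, Real.norm_eq_abs] at hi
  have hentry : ∀ j : Fin (k + 1), |Tridiag k (fun _ => 0) o i j| ≤
      (if (i : ℕ) + 1 = j then M else 0) + (if (j : ℕ) + 1 = i then M else 0) := by
    intro j
    rw [Tridiag_zero_apply]
    refine (abs_add_le _ _).trans (add_le_add ?_ ?_)
    · split_ifs with h
      · exact ho _ (by omega)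
      · simp
    · split_ifs with h
      · exact ho _ (by omega)
      · simp
  have hsum : ∀ p : Fin (k + 1) → Prop, ∀ [DecidablePred p], (∀ x y, p x → p y → x = y) →
      ∑ j, (if p j then M else 0) ≤ M := by
    intro p _ hp
    rw [← Finset.sum_filter, Finset.sum_const, nsmul_eq_mul]
    have hcard : (Finset.univ.filter p).card ≤ 1 :=
      Finset.card_le_one.2 fun x hx y hy =>
        hp x y (Finset.mem_filter.1 hx).2 (Finset.mem_filter.1 hy).2
    have : ((Finset.univ.filter p).card : ℝ) ≤ 1 := by exact_mod_cast hcard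
    nlinarith
  calc μ ≤ |μ| := le_abs_self μ
    _ ≤ ∑ j ∈ Finset.univ.erase i, |Tridiag k (fun _ => 0) o i j| := hi
    _ ≤ ∑ j, |Tridiag k (fun _ => 0) o i j| :=
        Finset.sum_le_sum_of_subset_of_nonneg (Finset.erase_subset _ _)
          fun _ _ _ => abs_nonneg _
    _ ≤ ∑ j : Fin (k + 1),
          ((if (i : ℕ) + 1 = j then M else 0) + (if (j : ℕ) + 1 = i then M else 0)) :=
        Finset.sum_le_sum fun j _ => hentry j
    _ ≤ M + M := by
        rw [Finset.sum_add_distrib]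
        exact add_le_add (hsum _ fun x y hx hy => Fin.ext (by omega))
          (hsum _ fun x y hx hy => Fin.ext (by omega))
    _ = 2 * M := by ring

theorem maxEig_Tridiag_le {k : ℕ} {o : ℕ → ℝ} {M : ℝ} (hM : 0 ≤ M)
    (ho : ∀ i < k, |o i| ≤ M) : maxEig (Tridiag k (fun _ => 0) o) ≤ 2 * M :=
  Real.sSup_le (fun _ hμ => Tridiag_eigenvalue_le hM ho hμ) (by positivity)

/-- The Rayleigh quotients of a symmetric matrix are at most its largest eigenvalue. -/
theorem dotProduct_mulVec_le_maxEig {m : ℕ} {A : Matrix (Fin m) (Fin m) ℝ}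
    (hA : A.IsHermitian) (v : Fin m → ℝ) :
    v ⬝ᵥ A.mulVec v ≤ maxEig A * (v ⬝ᵥ v) := by
  set c := maxEig A with hc
  have hbdd : BddAbove {μ : ℝ | Module.End.HasEigenvalue (Matrix.toLin' A) μ} :=
    (Module.End.finite_hasEigenvalue (Matrix.toLin' A)).bddAbove
  have hB : (c • (1 : Matrix (Fin m) (Fin m) ℝ) - A).IsHermitian := by
    refine Matrix.IsHermitian.sub ?_ hA
    rw [Matrix.IsHermitian, Matrix.conjTranspose_smul, Matrix.conjTranspose_one, star_trivial]
  have hpos : (c • (1 : Matrix (Fin m) (Fin m) ℝ) - A).PosSemidef := by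
    rw [hB.posSemidef_iff_eigenvalues_nonneg]
    intro i
    have hev := hB.mulVec_eigenvectorBasis i
    have hne : (hB.eigenvectorBasis i).ofLp ≠ 0 := fun h =>
      hB.eigenvectorBasis.toBasis.ne_zero i (by
        rw [OrthonormalBasis.coe_toBasis]
        exact (WithLp.ofLp_eq_zero 2).1 h)
    have hle : c - hB.eigenvalues i ≤ c := by
      refine le_csSup hbdd (Module.End.hasEigenvalue_of_hasEigenvector
        (x := (hB.eigenvectorBasis i).ofLp) ⟨Module.End.mem_eigenspace_iff.2 ?_, hne⟩)
      rw [Matrix.sub_mulVec, Matrix.smul_mulVec, Matrix.one_mulVec] at hev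
      rw [Matrix.toLin'_apply, sub_smul, ← hev]
      abel
    simpa using hle
  have h := hpos.dotProduct_mulVec_nonneg v
  rw [Matrix.sub_mulVec, Matrix.smul_mulVec, Matrix.one_mulVec, star_trivial,
    dotProduct_sub, dotProduct_smul, smul_eq_mul] at h
  linarith

theorem Tridiag_dotProduct_mulVec (k : ℕ) (o v : ℕ → ℝ) :
    (fun i : Fin (k + 1) => v i) ⬝ᵥ
        (Tridiag k (fun _ => 0) o).mulVec (fun i : Fin (k + 1) => v i) =
      2 * ∑ i ∈ Finset.range k, o i * v i * v (i + 1) := by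
  have hhalf : ∑ i : Fin (k + 1), ∑ j : Fin (k + 1),
      (if (i : ℕ) + 1 = j then o i * v i * v j else 0) =
        ∑ i ∈ Finset.range k, o i * v i * v (i + 1) := by
    rw [Fin.sum_univ_eq_sum_range
      (fun i => ∑ j : Fin (k + 1), if i + 1 = (j : ℕ) then o i * v i * v j else 0),
      Finset.sum_range_succ]
    have hlast : ∑ j : Fin (k + 1), (if k + 1 = (j : ℕ) then o k * v k * v j else 0) = 0 :=
      Finset.sum_eq_zero fun j _ => if_neg (by omega)
    rw [hlast, add_zero]
    refine Finset.sum_congr rfl fun i hi => ?_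
    rw [Fin.sum_univ_eq_sum_range (fun j => if i + 1 = j then o i * v i * v j else 0),
      Finset.sum_ite_eq, if_pos]
    have := Finset.mem_range.1 hi
    exact Finset.mem_range.2 (by omega)
  have hsplit : (fun i : Fin (k + 1) => v i) ⬝ᵥ
        (Tridiag k (fun _ => 0) o).mulVec (fun i : Fin (k + 1) => v i) =
      ∑ i : Fin (k + 1), ∑ j : Fin (k + 1),
          (if (i : ℕ) + 1 = j then o i * v i * v j else 0) +
        ∑ i : Fin (k + 1), ∑ j : Fin (k + 1),
          (if (j : ℕ) + 1 = i then o j * v j * v i else 0) := by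
    simp only [dotProduct, Matrix.mulVec, Finset.mul_sum, Tridiag_zero_apply,
      ← Finset.sum_add_distrib]
    refine Finset.sum_congr rfl fun i _ => Finset.sum_congr rfl fun j _ => ?_
    split_ifs <;> ring
  rw [hsplit, Finset.sum_comm (f := fun i j : Fin (k + 1) =>
    if (j : ℕ) + 1 = i then o j * v j * v i else 0), hhalf]
  ring

/-- Lower bound on the largest eigenvalue from the indicator vector of the last `m + 1`
coordinates. -/
theorem le_maxEig_Tridiag {k m : ℕ} (hm : m ≤ k) {o : ℕ → ℝ} {s : ℝ}
    (ho : ∀ i < k, k ≤ i + m → s ≤ o i) :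
    2 * (m * s) ≤ maxEig (Tridiag k (fun _ => 0) o) * (m + 1) := by
  set v : ℕ → ℝ := fun i => if k ≤ i + m then 1 else 0 with hv
  have h := dotProduct_mulVec_le_maxEig (Tridiag_isHermitian k o) (fun i => v i)
  have hnorm : (fun i : Fin (k + 1) => v i) ⬝ᵥ (fun i : Fin (k + 1) => v i) = m + 1 := by
    rw [dotProduct, Fin.sum_univ_eq_sum_range (fun i => v i * v i)]
    simp only [hv, mul_ite, mul_one, mul_zero]
    have hfilter : (Finset.range (k + 1)).filter (fun i => k ≤ i + m) =
        Finset.Ico (k - m) (k + 1) := by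
      ext i
      simp only [Finset.mem_filter, Finset.mem_range, Finset.mem_Ico]
      omega
    have hcard : k + 1 - (k - m) = m + 1 := by omega
    simp [← ite_and, hfilter, hcard]
  have hquad : m * s ≤ ∑ i ∈ Finset.range k, o i * v i * v (i + 1) := by
    have hsub : Finset.Ico (k - m) k ⊆ Finset.range k := fun i hi =>
      Finset.mem_range.2 (Finset.mem_Ico.1 hi).2
    rw [← Finset.sum_subset hsub]
    · have hcard : (Finset.Ico (k - m) k).card = m := by
        rw [Nat.card_Ico]
        omega
      have hterm : ∀ i ∈ Finset.Ico (k - m) k, s ≤ o i * v i * v (i + 1) := fun i hi => by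
        have hi' := Finset.mem_Ico.1 hi
        simp only [hv]
        rw [if_pos (by omega), if_pos (by omega), mul_one, mul_one]
        exact ho i hi'.2 (by omega)
      simpa [hcard] using Finset.card_nsmul_le_sum _ _ _ hterm
    · intro i hi hi'
      have h1 := Finset.mem_range.1 hi
      rw [Finset.mem_Ico] at hi'
      simp only [hv]
      rw [if_neg (c := k ≤ i + m) (by omega)]
      ring
  rw [Tridiag_dotProduct_mulVec, hnorm] at h
  linarith

theorem maxEig_krawtchouk_div_le {n k : ℕ} (hn : 0 < n) (hkn : 2 * k ≤ n) :
    maxEig (Tridiag k (fun _ => 0)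
      (fun i => Real.sqrt (((i : ℝ) + 1) * ((n : ℝ) - i)))) / (n : ℝ) ≤
      2 * Real.sqrt ((k : ℝ) / n * (1 + 1 / n - (k : ℝ) / n)) := by
  have hn' : (0 : ℝ) < n := by exact_mod_cast hn
  have hkn' : 2 * (k : ℝ) ≤ n := by exact_mod_cast hkn
  have hk0 : (0 : ℝ) ≤ k := k.cast_nonneg
  have hM : maxEig (Tridiag k (fun _ => 0)
      (fun i => Real.sqrt (((i : ℝ) + 1) * ((n : ℝ) - i)))) ≤
      2 * Real.sqrt ((k : ℝ) * (n + 1 - k)) := by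
    refine maxEig_Tridiag_le (Real.sqrt_nonneg _) fun i hi => ?_
    rw [abs_of_nonneg (Real.sqrt_nonneg _)]
    have hi' : (i : ℝ) + 1 ≤ k := by exact_mod_cast hi
    exact Real.sqrt_le_sqrt (by nlinarith)
  have heq : (k : ℝ) / n * (1 + 1 / n - (k : ℝ) / n) = (k : ℝ) * (n + 1 - k) / (n : ℝ) ^ 2 := by
    field_simp
  rw [heq, Real.sqrt_div' _ (sq_nonneg _), Real.sqrt_sq hn'.le, ← mul_div_assoc]
  gcongr

theorem le_maxEig_krawtchouk_div {n k m : ℕ} (hn : 0 < n) (hm : m ≤ k) (hkn : k ≤ n) :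
    2 * ((m : ℝ) / (m + 1)) *
        Real.sqrt (((k : ℝ) / n - (m : ℝ) / n) * (1 - (k : ℝ) / n)) ≤
      maxEig (Tridiag k (fun _ => 0)
        (fun i => Real.sqrt (((i : ℝ) + 1) * ((n : ℝ) - i)))) / (n : ℝ) := by
  have hn' : (0 : ℝ) < n := by exact_mod_cast hn
  have hkn' : (k : ℝ) ≤ n := by exact_mod_cast hkn
  have h := le_maxEig_Tridiag hm (s := Real.sqrt (((k : ℝ) - m) * (n - k)))
    (o := fun i => Real.sqrt (((i : ℝ) + 1) * ((n : ℝ) - i))) (by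
      intro i hi hki
      have h1 : (i : ℝ) + 1 ≤ k := by exact_mod_cast hi
      have h2 : (k : ℝ) ≤ i + m := by exact_mod_cast hki
      have h3 : (0 : ℝ) ≤ i := i.cast_nonneg
      apply Real.sqrt_le_sqrt
      apply mul_le_mul <;> linarith)
  have heq : ((k : ℝ) / n - (m : ℝ) / n) * (1 - (k : ℝ) / n) =
      ((k : ℝ) - m) * (n - k) / (n : ℝ) ^ 2 := by
    field_simp
  rw [heq, Real.sqrt_div' _ (sq_nonneg _), Real.sqrt_sq hn'.le, ← mul_div_assoc]
  gcongr
  have hm1 : (0 : ℝ) < m + 1 := by positivity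
  rw [← mul_div_assoc, div_mul_eq_mul_div, div_le_iff₀ hm1]
  linarith

/-- Asymptotics (9): the largest eigenvalue of the Krawtchouk tridiagonal matrix satisfies
`λmax(S_k)/n → 2√(τ(1-τ))` when `k/n → τ`. -/
theorem krawtchouk_maxEig_limit (τ : ℝ) (hτ0 : 0 < τ) (hτ : τ < 1 / 2)
    (n k : ℕ → ℕ) (hnpos : ∀ j, 0 < n j) (hkpos : ∀ j, 0 < k j)
    (hn : Tendsto n atTop atTop)
    (hk : Tendsto (fun j => (k j : ℝ) / (n j : ℝ)) atTop (nhds τ)) :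
    Tendsto (fun j =>
        maxEig (Tridiag (k j) (fun _ => 0)
          (fun i => Real.sqrt (((i : ℝ) + 1) * ((n j : ℝ) - i)))) / (n j : ℝ))
      atTop (nhds (2 * Real.sqrt (τ * (1 - τ)))) := by
  have hnR : Tendsto (fun j => (n j : ℝ)) atTop atTop := tendsto_natCast_atTop_atTop.comp hn
  have hnpos' : ∀ j, (0 : ℝ) < n j := fun j => by exact_mod_cast hnpos j
  have hkR : Tendsto (fun j => (k j : ℝ)) atTop atTop :=
    (hk.pos_mul_atTop hτ0 hnR).congr fun j => div_mul_cancel₀ _ (hnpos' j).ne'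
  have hkn : ∀ᶠ j in atTop, 2 * k j ≤ n j := by
    filter_upwards [hk.eventually (gt_mem_nhds hτ)] with j hj
    rw [div_lt_iff₀ (hnpos' j)] at hj
    have : 2 * (k j : ℝ) ≤ n j := by linarith
    exact_mod_cast this
  refine tendsto_order.2 ⟨fun a ha => ?_, fun b hb => ?_⟩
  · have hlim : Tendsto (fun m : ℕ => 2 * ((m : ℝ) / (m + 1)) * Real.sqrt (τ * (1 - τ)))
        atTop (nhds (2 * 1 * Real.sqrt (τ * (1 - τ)))) :=
      (tendsto_natCast_div_add_atTop (1 : ℝ)).const_mul 2 |>.mul_const _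
    rw [mul_one] at hlim
    obtain ⟨m, hm⟩ := (hlim.eventually (lt_mem_nhds ha)).exists
    have hj : Tendsto (fun j => 2 * ((m : ℝ) / (m + 1)) *
        Real.sqrt (((k j : ℝ) / n j - (m : ℝ) / n j) * (1 - (k j : ℝ) / n j))) atTop
        (nhds (2 * ((m : ℝ) / (m + 1)) * Real.sqrt ((τ - 0) * (1 - τ)))) :=
      (((hk.sub (hnR.const_div_atTop _)).mul (hk.const_sub 1)).sqrt).const_mul _
    rw [sub_zero] at hj
    filter_upwards [hj.eventually (lt_mem_nhds hm), hkn,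
      hkR.eventually_ge_atTop (m : ℝ)] with j h1 h2 h3
    exact h1.trans_le (le_maxEig_krawtchouk_div (hnpos j) (by exact_mod_cast h3) (by omega))
  · have hj : Tendsto (fun j => 2 * Real.sqrt ((k j : ℝ) / n j *
        (1 + 1 / n j - (k j : ℝ) / n j))) atTop
        (nhds (2 * Real.sqrt (τ * (1 + 0 - τ)))) :=
      ((hk.mul (((hnR.const_div_atTop 1).const_add 1).sub hk)).sqrt).const_mul 2
    rw [add_zero] at hj
    filter_upwards [hj.eventually (gt_mem_nhds hb), hkn] with j h1 h2
    exact (maxEig_krawtchouk_div_le (hnpos j) h2).trans_lt h1
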